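/- The set of positive integers n with μ(n) = 0 (i.e., non-squarefree n) has natural density 1 - 6/π²; that is, (1/n)·#{i : 1 ≤ i ≤ n, μ(i) = 0} tends to 1 - 6/π² as n → ∞. -/

import Mathlib

open Filter Real

theorem Nat.sq_dvd_sq_mul_iff_of_squarefree {a b d : ℕ} (ha : Squarefree a) (hb : 0 < b) :
    d ^ 2 ∣ b ^ 2 * a ↔ d ∣ b := by
  refine ⟨fun h => ?_, fun h => (pow_dvd_pow_of_dvd h 2).mul_right a⟩
  obtain ⟨g, d', b', hg, hc, rfl, rfl⟩ := Nat.exists_coprime' (m := d) (n := b)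
    (Nat.gcd_pos_of_pos_right d hb)
  rw [mul_pow, mul_pow, mul_right_comm] at h
  have hdvd : d' ^ 2 ∣ b' ^ 2 * a := Nat.dvd_of_mul_dvd_mul_right (by positivity) h
  have hda : d' * d' ∣ a := by
    simpa [sq] using (Nat.Coprime.pow 2 2 hc).dvd_of_dvd_mul_left hdvd
  simp [Nat.isUnit_iff.mp (ha d' hda)]

theorem ArithmeticFunction.sum_moebius_sq_dvd {i n : ℕ} (hi : 0 < i) (hin : i ≤ n) :
    ∑ d ∈ (Finset.Icc 1 n).filter (fun d => d ^ 2 ∣ i), moebius d =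
      if Squarefree i then 1 else 0 := by
  obtain ⟨a, b, ha, hb, rfl, hsq⟩ := Nat.sq_mul_squarefree_of_pos hi
  have hset : (Finset.Icc 1 n).filter (fun d => d ^ 2 ∣ b ^ 2 * a) = b.divisors := by
    ext d
    simp only [Finset.mem_filter, Finset.mem_Icc, Nat.mem_divisors,
      Nat.sq_dvd_sq_mul_iff_of_squarefree hsq hb]
    refine ⟨fun h => ⟨h.2, hb.ne'⟩, fun h => ⟨⟨Nat.pos_of_dvd_of_pos h.1 hb, ?_⟩, h.1⟩⟩
    exact (Nat.le_of_dvd hb h.1).trans <| (Nat.le_self_pow two_ne_zero b).trans <|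
      (Nat.le_mul_of_pos_right _ ha).trans hin
  have hiff : Squarefree (b ^ 2 * a) ↔ b = 1 := by
    refine ⟨fun h => Nat.isUnit_iff.mp (h b ?_), fun h => by simpa [h] using hsq⟩
    exact (sq b) ▸ dvd_mul_right _ _
  rw [hset, ← coe_mul_zeta_apply, moebius_mul_coe_zeta, one_apply]
  simp only [hiff]

theorem Nat.card_squarefree_Icc_eq_sum_moebius (n : ℕ) :
    (((Finset.Icc 1 n).filter Squarefree).card : ℤ) =
      ∑ d ∈ Finset.Icc 1 n, ArithmeticFunction.moebius d * (n / d ^ 2 : ℕ) := by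
  rw [Finset.card_filter]
  push_cast
  calc _ = ∑ i ∈ Finset.Icc 1 n, ∑ d ∈ Finset.Icc 1 n,
        if d ^ 2 ∣ i then ArithmeticFunction.moebius d else 0 := by
        refine Finset.sum_congr rfl fun i hi => ?_
        rw [Finset.mem_Icc] at hi
        rw [← Finset.sum_filter, ArithmeticFunction.sum_moebius_sq_dvd hi.1 hi.2]
    _ = _ := by
        rw [Finset.sum_comm]
        refine Finset.sum_congr rfl fun d _ => ?_
        rw [← Finset.sum_filter, Finset.sum_const, nsmul_eq_mul, mul_comm]
        have := Nat.Ioc_filter_dvd_card_eq_div n (d ^ 2)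
        rw [← Finset.Icc_add_one_left_eq_Ioc, zero_add] at this
        rw [this]
        push_cast
        rfl

theorem ArithmeticFunction.tsum_moebius_div_sq :
    ∑' d : ℕ, (moebius d : ℝ) / (d : ℝ) ^ 2 = 6 / π ^ 2 := by
  have h := LSeries_zeta_mul_Lseries_moebius (s := 2) (by norm_num)
  rw [LSeries_zeta_eq_riemannZeta (by norm_num), riemannZeta_two] at h
  have hL : LSeries (fun n => ((moebius n : ℤ) : ℂ)) 2 =
      ((∑' d : ℕ, (moebius d : ℝ) / (d : ℝ) ^ 2 : ℝ) : ℂ) := by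
    rw [LSeries, Complex.ofReal_tsum]
    refine tsum_congr fun d => ?_
    rcases eq_or_ne d 0 with rfl | hd
    · simp
    · rw [LSeries.term_of_ne_zero hd]
      norm_cast
  rw [hL] at h
  have h' : π ^ 2 / 6 * ∑' d : ℕ, (moebius d : ℝ) / (d : ℝ) ^ 2 = 1 := by exact_mod_cast h
  have := Real.pi_ne_zero
  field_simp at h' ⊢
  linarith

theorem Nat.tendsto_card_squarefree_Icc_div :
    Tendsto (fun n : ℕ => (((Finset.Icc 1 n).filter Squarefree).card : ℝ) / n)
      atTop (nhds (6 / π ^ 2)) := by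
  have hseries (n : ℕ) : (((Finset.Icc 1 n).filter Squarefree).card : ℝ) / n =
      ∑' d : ℕ, (ArithmeticFunction.moebius d : ℝ) * ((n / d ^ 2 : ℕ) / n : ℝ) := by
    rw [tsum_eq_sum (s := Finset.Icc 1 n)]
    · have h : (((Finset.Icc 1 n).filter Squarefree).card : ℝ) =
          ∑ d ∈ Finset.Icc 1 n, (ArithmeticFunction.moebius d : ℝ) * (n / d ^ 2 : ℕ) := by
        simpa only [Int.cast_sum, Int.cast_mul, Int.cast_natCast] using
          congrArg (Int.cast : ℤ → ℝ) (Nat.card_squarefree_Icc_eq_sum_moebius n)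
      rw [h, Finset.sum_div]
      simp only [mul_div_assoc]
    · intro d hd
      rcases Nat.eq_zero_or_pos d with rfl | hpos
      · simp
      · have hlt : n < d := by
          by_contra! hle
          exact hd (Finset.mem_Icc.mpr ⟨hpos, hle⟩)
        rw [Nat.div_eq_of_lt (hlt.trans_le (Nat.le_self_pow two_ne_zero d))]
        simp
  simp only [hseries]
  rw [← ArithmeticFunction.tsum_moebius_div_sq]
  refine tendsto_tsum_of_dominated_convergence (bound := fun d : ℕ => 1 / (d : ℝ) ^ 2)
    (Real.summable_one_div_nat_pow.mpr one_lt_two) (fun d => ?_) (Eventually.of_forall ?_)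
  · rw [div_eq_mul_one_div]
    refine Tendsto.const_mul _ ?_
    have h := (tendsto_nat_floor_mul_div_atTop (R := ℝ) (a := 1 / (d : ℝ) ^ 2)
      (by positivity)).comp tendsto_natCast_atTop_atTop
    refine h.congr fun n => ?_
    have hfloor : ⌊1 / (d : ℝ) ^ 2 * n⌋₊ = n / d ^ 2 := by
      rw [one_div_mul_eq_div]
      exact_mod_cast Nat.floor_div_eq_div (K := ℝ) n (d ^ 2)
    simp only [Function.comp_apply, hfloor]
  · intro n d
    have hμ : |(ArithmeticFunction.moebius d : ℝ)| ≤ 1 := by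
      exact_mod_cast ArithmeticFunction.abs_moebius_le_one
    have hdiv : ((n / d ^ 2 : ℕ) / n : ℝ) ≤ 1 / (d : ℝ) ^ 2 := by
      refine div_le_of_le_mul₀ (by positivity) (by positivity) ?_
      rw [one_div_mul_eq_div]
      exact_mod_cast Nat.cast_div_le (α := ℝ) (m := n) (n := d ^ 2)
    rw [norm_mul, Real.norm_eq_abs, Real.norm_of_nonneg (by positivity)]
    simpa using mul_le_mul hμ hdiv (by positivity) zero_le_one

theorem moebius_eq_zero_density :
    Tendsto (fun n : ℕ =>
      (((Finset.Icc 1 n).filter (fun i => ArithmeticFunction.moebius i = 0)).card : ℝ) / n)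
      atTop (nhds (1 - 6 / π ^ 2)) := by
  refine (Nat.tendsto_card_squarefree_Icc_div.const_sub 1).congr' ?_
  filter_upwards [eventually_gt_atTop 0] with n hn
  have hcard := Finset.card_filter_add_card_filter_not (s := Finset.Icc 1 n) Squarefree
  simp only [← ArithmeticFunction.moebius_ne_zero_iff_squarefree, not_not, Nat.card_Icc,
    Nat.add_sub_cancel] at hcard
  have hcard' : (((Finset.Icc 1 n).filter Squarefree).card : ℝ) +
      ((Finset.Icc 1 n).filter (fun i => ArithmeticFunction.moebius i = 0)).card = n := by
    simp only [← ArithmeticFunction.moebius_ne_zero_iff_squarefree]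
    exact_mod_cast hcard
  have hn' : (n : ℝ) ≠ 0 := by positivity
  rw [eq_div_iff hn', sub_mul, div_mul_cancel₀ _ hn']
  linarith
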